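/- Asymptotic upper bound on the spectral gap (Theorem 4.1(i)): for H_{k,α} = L_k + Σ_{j∈J} α_j δ_j with a non-zero, non-negative, compactly supported potential, there exists c_1 = c_1(α) > 0 such that |V_k|³ · Γ(V_k, α) ≤ c_1 for all k, where Γ(V_k,α) = λ_1(V_k,α) − λ_0(V_k,α) and |V_k| = 2k+1. In particular, lim_{k→∞} |V_k|^{2+η} Γ(V_k,α) = 0 for every η < 1. -/

import Mathlib

open Finset Filter Topology Matrix

/-- The (Neumann) discrete Laplacian matrix of the path graph with `n` vertices. -/
noncomputable def pathLap (n : ℕ) : Matrix (Fin n) (Fin n) ℝ :=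
  Matrix.of fun i j =>
    if i = j then (if i.val = 0 ∨ i.val = n - 1 then (1 : ℝ) else 2)
    else if i.val + 1 = j.val ∨ j.val + 1 = i.val then -1 else 0

/-- The diagonal potential matrix: vertex `i` of `Fin (2k+1)` represents the integer `i - k`. -/
noncomputable def potMat (k : ℕ) (α : ℤ → ℝ) : Matrix (Fin (2*k+1)) (Fin (2*k+1)) ℝ :=
  Matrix.diagonal fun i => α ((i : ℤ) - k)

/-- The discrete Schrödinger operator `H_{k,α} = L_k + Σ_j α_j δ_j` on the path `{-k,…,k}`. -/
noncomputable def Hmat (k : ℕ) (α : ℤ → ℝ) : Matrix (Fin (2*k+1)) (Fin (2*k+1)) ℝ :=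
  pathLap (2*k+1) + potMat k α

/-- The set of eigenvalues of a real matrix. -/
def evs {n : ℕ} (M : Matrix (Fin n) (Fin n) ℝ) : Set ℝ :=
  {μ | ∃ f : Fin n → ℝ, f ≠ 0 ∧ M.mulVec f = μ • f}

/-- Lowest eigenvalue. -/
noncomputable def lam0 {n : ℕ} (M : Matrix (Fin n) (Fin n) ℝ) : ℝ := sInf (evs M)

/-- Second-lowest eigenvalue (lowest eigenvalue above the ground state energy). -/
noncomputable def lam1 {n : ℕ} (M : Matrix (Fin n) (Fin n) ℝ) : ℝ :=
  sInf (evs M \ {lam0 M})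

/-- Spectral gap. -/
noncomputable def gap {n : ℕ} (M : Matrix (Fin n) (Fin n) ℝ) : ℝ := lam1 M - lam0 M

/-- `λ_0(V_m, ∞δ_0) = 2 - 2cos(π/(2m+1))`, the Dirichlet ground state energy. -/
noncomputable def dirEVZ (m : ℤ) : ℝ := 2 - 2 * Real.cos (Real.pi / (2 * m + 1))

/-- Index of the integer vertex `j ∈ {-k,…,k}` inside `Fin (2k+1)`. -/
def idx (k : ℕ) (j : ℤ) : Fin (2*k+1) := ⟨(j + k).toNat % (2*k+1), Nat.mod_lt _ (by omega)⟩

/-- `φ` is the normalized strictly positive ground state of `H_{k,α}`. -/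
noncomputable def isGS (k : ℕ) (α : ℤ → ℝ) (φ : Fin (2*k+1) → ℝ) : Prop :=
  (Hmat k α).mulVec φ = lam0 (Hmat k α) • φ ∧ (∑ i, φ i ^ 2 = 1) ∧ ∀ i, 0 < φ i

/-- The single-site potential `α δ_0`. -/
noncomputable def single0 (α : ℝ) : ℤ → ℝ := fun j => if j = 0 then α else 0

/-- Eigenvalues of a matrix with nonpositive off-diagonal entries are bounded below by `l` as soon
as there is a positive vector `u` with `l • u ≤ M *ᵥ u` (Barta's inequality). -/
theorem le_of_mem_evs_of_supersolution {n : ℕ} {M : Matrix (Fin n) (Fin n) ℝ} {u : Fin n → ℝ}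
    {l μ : ℝ} (hoff : ∀ i j, i ≠ j → M i j ≤ 0) (hu : ∀ i, 0 < u i)
    (hsup : ∀ i, l * u i ≤ (M *ᵥ u) i) (hμ : μ ∈ evs M) : l ≤ μ := by
  obtain ⟨f, hf0, hf⟩ := hμ
  obtain ⟨i₀, hi₀⟩ : ∃ i, f i ≠ 0 := Function.ne_iff.mp hf0
  obtain ⟨i, -, hi⟩ := Finset.exists_max_image univ (fun i => |f i| / u i) ⟨i₀, mem_univ _⟩
  set t := |f i| / u i with ht
  have htpos : 0 < t :=
    lt_of_lt_of_le (div_pos (abs_pos.mpr hi₀) (hu i₀)) (hi i₀ (mem_univ _))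
  have hfi : |f i| = t * u i := by rw [ht, div_mul_cancel₀ _ (hu i).ne']
  have key : ∀ g : Fin n → ℝ, (∀ j, |g j| = |f j|) → g i = |f i| → M *ᵥ g = μ • g → l ≤ μ := by
    intro g hg hgi hMg
    have h1 : (M *ᵥ (t • u)) i ≤ (M *ᵥ g) i := by
      rw [Matrix.mulVec, Matrix.mulVec, dotProduct, dotProduct]
      refine Finset.sum_le_sum fun j _ => ?_
      by_cases hij : i = j
      · subst hij; simp [hgi, hfi]
      · refine mul_le_mul_of_nonpos_left ?_ (hoff i j hij)
        have h2 := hi j (mem_univ _)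
        rw [div_le_iff₀ (hu j)] at h2
        calc g j ≤ |g j| := le_abs_self _
          _ = |f j| := hg j
          _ ≤ _ := h2
    rw [hMg, Matrix.mulVec_smul, Pi.smul_apply, Pi.smul_apply, smul_eq_mul, smul_eq_mul, hgi,
      hfi] at h1
    have h3 := mul_le_mul_of_nonneg_left (hsup i) htpos.le
    have h4 : l * (t * u i) ≤ μ * (t * u i) := by linarith
    exact le_of_mul_le_mul_right h4 (mul_pos htpos (hu i))
  rcases le_total 0 (f i) with h | h
  · exact key f (fun _ => rfl) (abs_of_nonneg h).symm hf
  · refine key (-f) (fun j => by simp) (by simp [abs_of_nonpos h]) ?_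
    rw [Matrix.mulVec_neg, hf, smul_neg]

theorem evs_nonempty {n : ℕ} {M : Matrix (Fin n) (Fin n) ℝ} (hM : M.IsHermitian) (i : Fin n) :
    (evs M).Nonempty := by
  refine ⟨hM.eigenvalues i, hM.eigenvectorBasis i, fun h => ?_, hM.mulVec_eigenvectorBasis i⟩
  exact hM.eigenvectorBasis.orthonormal.ne_zero i (by ext j; exact congrFun h j)

/-- A vector orthogonal to the `l`-eigenspace of a symmetric matrix, with Rayleigh quotient at most
`E`, forces an eigenvalue other than `l` that is at most `E`. -/
theorem exists_mem_evs_le {n : ℕ} {M : Matrix (Fin n) (Fin n) ℝ} (hM : M.IsHermitian) {l E : ℝ}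
    {f : Fin n → ℝ} (hf0 : f ≠ 0) (horth : ∀ v, M *ᵥ v = l • v → f ⬝ᵥ v = 0)
    (hf : f ⬝ᵥ (M *ᵥ f) ≤ E * (f ⬝ᵥ f)) : ∃ μ ∈ evs M \ {l}, μ ≤ E := by
  by_contra! hcon
  let b : Fin n → Fin n → ℝ := fun i => hM.eigenvectorBasis i
  have hb : ∀ i, M *ᵥ b i = hM.eigenvalues i • b i := hM.mulVec_eigenvectorBasis
  have hb0 : ∀ i, b i ≠ 0 := fun i h =>
    hM.eigenvectorBasis.orthonormal.ne_zero i (by ext j; exact congrFun h j)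
  have parseval : ∀ x y : Fin n → ℝ, ∑ i, (x ⬝ᵥ b i) * (b i ⬝ᵥ y) = x ⬝ᵥ y := by
    intro x y
    have := hM.eigenvectorBasis.sum_inner_mul_inner (WithLp.toLp 2 x) (WithLp.toLp 2 y)
    simp only [EuclideanSpace.inner_eq_star_dotProduct, star_trivial] at this
    rw [dotProduct_comm x y, ← this]
    exact Finset.sum_congr rfl fun i _ => by
      rw [dotProduct_comm x, dotProduct_comm _ y]
  have hsymm : ∀ i, b i ⬝ᵥ (M *ᵥ f) = hM.eigenvalues i * (f ⬝ᵥ b i) := by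
    intro i
    have hT : Mᵀ = M := by
      rw [← Matrix.conjTranspose_eq_transpose_of_trivial]; exact hM
    rw [Matrix.dotProduct_mulVec, ← Matrix.mulVec_transpose, hT, hb, smul_dotProduct, smul_eq_mul,
      dotProduct_comm]
  have hterm : ∀ i, 0 ≤ (hM.eigenvalues i - E) * (f ⬝ᵥ b i) ^ 2 := by
    intro i
    by_cases h : hM.eigenvalues i = l
    · rw [horth (b i) (h ▸ hb i)]; simp
    · exact mul_nonneg (sub_nonneg.mpr (hcon _ ⟨⟨b i, hb0 i, hb i⟩, h⟩).le) (sq_nonneg _)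
  have hsum : ∑ i, (hM.eigenvalues i - E) * (f ⬝ᵥ b i) ^ 2 ≤ 0 := by
    rw [← parseval f f, ← parseval f (M *ᵥ f), Finset.mul_sum, ← sub_nonpos,
      ← Finset.sum_sub_distrib] at hf
    refine le_of_eq_of_le (Finset.sum_congr rfl fun i _ => ?_) hf
    rw [hsymm, dotProduct_comm (b i) f]
    ring
  have hzero := (Finset.sum_eq_zero_iff_of_nonneg fun i _ => hterm i).mp
    (le_antisymm hsum (Finset.sum_nonneg fun i _ => hterm i))
  have hcoef : ∀ i, f ⬝ᵥ b i = 0 := by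
    intro i
    by_cases h : hM.eigenvalues i = l
    · exact horth (b i) (h ▸ hb i)
    · have h1 := hcon _ ⟨⟨b i, hb0 i, hb i⟩, h⟩
      exact pow_eq_zero_iff two_ne_zero |>.mp
        ((mul_eq_zero.mp (hzero i (mem_univ i))).resolve_left (sub_pos.mpr h1).ne')
  refine hf0 (dotProduct_self_eq_zero.mp ?_)
  rw [← parseval]
  simp [hcoef]

theorem Hmat_isHermitian (k : ℕ) (α : ℤ → ℝ) : (Hmat k α).IsHermitian := by
  refine Matrix.IsHermitian.add ?_ (by simp [potMat])
  ext i j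
  simp only [pathLap, Matrix.conjTranspose_apply, Matrix.of_apply, star_trivial]
  by_cases h : i = j
  · subst h; rfl
  · rw [if_neg h, if_neg (Ne.symm h)]
    simp only [or_comm]

theorem Hmat_apply_of_ne {k : ℕ} (α : ℤ → ℝ) {i j : Fin (2 * k + 1)} (h : i ≠ j) :
    Hmat k α i j = if i.val + 1 = j.val ∨ j.val + 1 = i.val then -1 else 0 := by
  simp [Hmat, pathLap, potMat, h]

/-- Action of the path Laplacian on the restriction of a function with Neumann boundary values. -/
theorem pathLap_mulVec {n : ℕ} (hn : 2 ≤ n) (F : ℤ → ℝ) (h0 : F (-1) = F 0)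
    (h1 : F n = F (n - 1)) (i : Fin n) :
    (pathLap n *ᵥ fun j : Fin n => F (j : ℕ)) i = 2 * F i - F (i - 1) - F (i + 1) := by
  obtain ⟨i, hi⟩ := i
  have hentry : ∀ j : Fin n, pathLap n ⟨i, hi⟩ j * F (j : ℕ) =
      (if i = (j : ℕ) then (if i = 0 ∨ i = n - 1 then (1 : ℝ) else 2) * F (j : ℕ) else 0)
      - (if i + 1 = (j : ℕ) then F (j : ℕ) else 0)
      - (if (j : ℕ) + 1 = i then F (j : ℕ) else 0) := by
    rintro ⟨j, hj⟩
    simp only [pathLap, Matrix.of_apply, Fin.mk.injEq]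
    split_ifs <;> first | omega | ring
  simp only [Matrix.mulVec, dotProduct]
  rw [Finset.sum_congr rfl fun j _ => hentry j, Finset.sum_sub_distrib, Finset.sum_sub_distrib,
    Fin.sum_univ_eq_sum_range
      (fun j => if i = j then (if i = 0 ∨ i = n - 1 then (1 : ℝ) else 2) * F (j : ℕ) else 0),
    Fin.sum_univ_eq_sum_range (fun j => if i + 1 = j then F (j : ℕ) else 0),
    Fin.sum_univ_eq_sum_range (fun j => if j + 1 = i then F (j : ℕ) else 0),
    Finset.sum_ite_eq, Finset.sum_ite_eq, if_pos (mem_range.mpr hi)]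
  have hlast : ∑ j ∈ range n, (if j + 1 = i then F (j : ℕ) else 0) =
      if i = 0 then 0 else F ((i : ℤ) - 1) := by
    rcases i with _ | i
    · simp
    · simp only [Nat.add_right_cancel_iff, Finset.sum_ite_eq', mem_range]
      rw [if_pos (by omega), if_neg (by omega)]
      push_cast
      congr 1
      ring
  rw [hlast]
  simp only [mem_range]
  by_cases hi0 : i = 0
  · subst hi0
    rw [if_pos (Or.inl rfl), if_pos (by omega : 0 + 1 < n), if_pos rfl]
    simp only [Nat.cast_zero, zero_sub, h0]
    push_cast
    ring
  by_cases hin : i = n - 1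
  · rw [if_pos (Or.inr hin), if_neg (by omega), if_neg hi0]
    have e1 : (i : ℤ) + 1 = n := by omega
    have e2 : (n : ℤ) - 1 = i := by omega
    rw [e1, h1, e2]
    ring
  · rw [if_neg (by omega), if_pos (by omega), if_neg hi0]
    push_cast
    ring

theorem Hmat_mulVec {k : ℕ} (hk : 1 ≤ k) (α : ℤ → ℝ) (F : ℤ → ℝ) (h0 : F (-1) = F 0)
    (h1 : F (2 * k + 1) = F (2 * k)) (i : Fin (2 * k + 1)) :
    (Hmat k α *ᵥ fun j : Fin (2 * k + 1) => F (j : ℕ)) i =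
      2 * F i - F (i - 1) - F (i + 1) + α (i - k) * F i := by
  rw [Hmat, Matrix.add_mulVec, Pi.add_apply, pathLap_mulVec (by omega) F h0 (by push_cast; simpa),
    potMat, Matrix.mulVec_diagonal]

theorem eq_zero_of_Hmat_mulVec_eq_smul {k : ℕ} {α : ℤ → ℝ} {l : ℝ} {v : Fin (2 * k + 1) → ℝ}
    (hv : Hmat k α *ᵥ v = l • v) (h0 : v 0 = 0) : v = 0 := by
  have key : ∀ m : ℕ, ∀ j : Fin (2 * k + 1), j.val ≤ m → v j = 0 := by
    intro m
    induction m with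
    | zero =>
      intro j hj
      have : j = 0 := Fin.ext (by simpa using hj)
      rw [this, h0]
    | succ m ih =>
      intro j hj
      rcases Nat.lt_or_ge j.val (m + 1) with h | h
      · exact ih j (by omega)
      let i : Fin (2 * k + 1) := ⟨m, by omega⟩
      have hrow := congrFun hv i
      rw [Pi.smul_apply, ih i le_rfl, smul_zero, Matrix.mulVec, dotProduct,
        Finset.sum_eq_single j] at hrow
      · have hij : i ≠ j := fun e => by have := congrArg Fin.val e; simp only [i] at this; omega
        rw [Hmat_apply_of_ne α hij, if_pos (Or.inl (by simp only [i]; omega))] at hrow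
        linarith
      · intro j' _ hj'
        rcases Nat.lt_or_ge m j'.val with h' | h'
        · have hne : j'.val ≠ j.val := fun e => hj' (Fin.ext e)
          rw [Hmat_apply_of_ne α (fun e => by
            have := congrArg Fin.val e; simp only [i] at this; omega),
            if_neg (by simp only [i]; omega), zero_mul]
        · rw [ih j' h', mul_zero]
      · simp
  exact funext fun j => key j.val j le_rfl

/-- The eigenspaces of `Hmat` are at most one-dimensional, so every plane contains a nonzero vector
orthogonal to a given one. -/
theorem exists_comb_orthogonal {k : ℕ} (α : ℤ → ℝ) (l : ℝ) (f g : Fin (2 * k + 1) → ℝ) :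
    ∃ c d : ℝ, (c ≠ 0 ∨ d ≠ 0) ∧
      ∀ v, Hmat k α *ᵥ v = l • v → (c • f + d • g) ⬝ᵥ v = 0 := by
  by_cases h : ∀ v, Hmat k α *ᵥ v = l • v → f ⬝ᵥ v = 0
  · exact ⟨1, 0, Or.inl one_ne_zero, fun v hv => by simp [h v hv]⟩
  push Not at h
  obtain ⟨w, hw, hfw⟩ := h
  refine ⟨g ⬝ᵥ w, -(f ⬝ᵥ w), Or.inr (neg_ne_zero.mpr hfw), fun v hv => ?_⟩
  have hw0 : w 0 ≠ 0 := fun e => hfw (by rw [eq_zero_of_Hmat_mulVec_eq_smul hw e]; simp)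
  have hprop : w 0 • v - v 0 • w = 0 := by
    refine eq_zero_of_Hmat_mulVec_eq_smul (k := k) (α := α) (l := l) ?_ ?_
    · rw [Matrix.mulVec_sub, Matrix.mulVec_smul, Matrix.mulVec_smul, hv, hw, smul_sub,
        smul_comm l, smul_comm l]
    · simp [mul_comm]
  have hzero : w 0 * (((g ⬝ᵥ w) • f + (-(f ⬝ᵥ w)) • g) ⬝ᵥ v) = 0 := by
    rw [← smul_eq_mul, ← dotProduct_smul, sub_eq_zero.mp hprop, dotProduct_smul, add_dotProduct,
      smul_dotProduct, smul_dotProduct]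
    simp only [smul_eq_mul]
    ring
  exact (mul_eq_zero.mp hzero).resolve_left hw0

theorem two_mul_cos_sub_cos_sub_cos (x θ : ℝ) :
    2 * Real.cos x - Real.cos (x - θ) - Real.cos (x + θ) =
      (2 - 2 * Real.cos θ) * Real.cos x := by
  rw [Real.cos_sub, Real.cos_add]
  ring

theorem evs_Hmat_nonneg {k : ℕ} (hk : 1 ≤ k) {α : ℤ → ℝ} (hα : ∀ j, 0 ≤ α j) {μ : ℝ}
    (hμ : μ ∈ evs (Hmat k α)) : 0 ≤ μ := by
  refine le_of_mem_evs_of_supersolution (u := fun _ => 1) (fun i j h => ?_) (fun _ => one_pos)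
    (fun i => ?_) hμ
  · rw [Hmat_apply_of_ne α h]; split_ifs <;> norm_num
  · rw [Hmat_mulVec hk α (fun _ => 1) rfl rfl]
    have := hα (i - k)
    linarith

/-- Ground state of the path on `m` vertices with a Dirichlet condition at its right end, extended
by zero. -/
noncomputable def dirichletGS (m : ℤ) (z : ℤ) : ℝ :=
  if z < m then Real.cos (Real.pi / (2 * m + 1) * (z + 1 / 2)) else 0

theorem dirichletGS_of_lt {m z : ℤ} (h : z < m) :
    dirichletGS m z = Real.cos (Real.pi / (2 * m + 1) * (z + 1 / 2)) := if_pos h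

theorem dirichletGS_of_le {m z : ℤ} (h : m ≤ z) : dirichletGS m z = 0 := if_neg (not_lt.mpr h)

theorem dirichletGS_neg_one {m : ℤ} (hm : 0 < m) : dirichletGS m (-1) = dirichletGS m 0 := by
  rw [dirichletGS_of_lt hm, dirichletGS_of_lt (by omega), ← Real.cos_neg]
  congr 1
  push_cast
  ring

theorem dirichletGS_eq_of_le {m z : ℤ} (hm : 0 < m) (h : z ≤ m) :
    dirichletGS m z = Real.cos (Real.pi / (2 * m + 1) * (z + 1 / 2)) := by
  rcases h.lt_or_eq with h | rfl
  · exact dirichletGS_of_lt h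
  · have h1 : (0 : ℝ) < z := by exact_mod_cast hm
    rw [dirichletGS_of_le le_rfl, ← Real.cos_pi_div_two]
    congr 1
    field_simp

theorem dirichletGS_laplacian {m z : ℤ} (hm : 0 < m) (h : z < m) :
    2 * dirichletGS m z - dirichletGS m (z - 1) - dirichletGS m (z + 1) =
      dirEVZ m * dirichletGS m z := by
  rw [dirichletGS_eq_of_le hm h.le, dirichletGS_eq_of_le hm (by omega : z - 1 ≤ m),
    dirichletGS_eq_of_le hm (by omega : z + 1 ≤ m), dirEVZ, ← two_mul_cos_sub_cos_sub_cos]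
  congr 2
  · congr 1
    push_cast
    ring
  · push_cast
    ring

theorem dirichletGS_zero_pos {m : ℤ} (hm : 0 < m) : 0 < dirichletGS m 0 := by
  rw [dirichletGS_of_lt hm]
  have h1 : (1 : ℝ) ≤ m := by exact_mod_cast hm
  have h2 : Real.pi / (2 * m + 1) ≤ Real.pi / 1 :=
    div_le_div_of_nonneg_left Real.pi_pos.le one_pos (by linarith)
  have h3 : 0 < Real.pi / (2 * (m : ℝ) + 1) := by positivity
  have h4 : Real.pi / (2 * (m : ℝ) + 1) < Real.pi := by
    rw [div_lt_iff₀ (by linarith)]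
    nlinarith [Real.pi_pos]
  refine Real.cos_pos_of_mem_Ioo ⟨?_, ?_⟩ <;> push_cast <;> linarith

/-- Some eigenvalue other than `l` lies below the Dirichlet energy of the two intervals that the
support of the potential leaves free. -/
theorem exists_evs_Hmat_le_dirEVZ {k a : ℕ} (hak : a < k) {α : ℤ → ℝ}
    (hα : ∀ j, α j ≠ 0 → |j| ≤ a) (l : ℝ) :
    ∃ μ ∈ evs (Hmat k α) \ {l}, μ ≤ dirEVZ (k - a) := by
  set m : ℤ := k - a with hm
  have hm0 : 0 < m := by omega
  obtain ⟨c, d, hcd, horth⟩ := exists_comb_orthogonal α l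
    (fun i : Fin (2 * k + 1) => dirichletGS m (i : ℕ))
    (fun i : Fin (2 * k + 1) => dirichletGS m (2 * k - (i : ℕ)))
  let F : ℤ → ℝ := fun z => c * dirichletGS m z + d * dirichletGS m (2 * k - z)
  have hF : (c • (fun i : Fin (2 * k + 1) => dirichletGS m (i : ℕ)) +
      d • (fun i : Fin (2 * k + 1) => dirichletGS m (2 * k - (i : ℕ)))) =
      fun i : Fin (2 * k + 1) => F (i : ℕ) := rfl
  rw [hF] at horth
  refine exists_mem_evs_le (Hmat_isHermitian k α) (fun h => ?_) horth (le_of_eq ?_)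
  · have hpos := dirichletGS_zero_pos hm0
    have hfar : dirichletGS m (2 * k) = 0 := dirichletGS_of_le (by omega)
    rcases hcd with hc | hd
    · have := congrFun h ⟨0, by omega⟩
      simp [F, hfar, hc, hpos.ne'] at this
    · have := congrFun h ⟨2 * k, by omega⟩
      simp [F, hfar, hd, hpos.ne'] at this
  · have hα0 : ∀ z : ℤ, a < |z| → α z = 0 := fun z hz => by
      by_contra h
      exact absurd (hα z h) (not_le.mpr hz)
    have h1 : F (-1) = F 0 := by
      simp only [F]
      rw [dirichletGS_neg_one hm0, dirichletGS_of_le (z := 2 * k - -1) (by omega),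
        dirichletGS_of_le (z := 2 * k - 0) (by omega)]
    have h2 : F (2 * k + 1) = F (2 * k) := by
      simp only [F]
      rw [dirichletGS_of_le (z := 2 * k + 1) (by omega), dirichletGS_of_le (z := 2 * k) (by omega),
        show (2 * k - (2 * k + 1) : ℤ) = -1 by ring, sub_self, dirichletGS_neg_one hm0]
    rw [dotProduct, dotProduct, Finset.mul_sum]
    refine Finset.sum_congr rfl fun i _ => ?_
    rw [Hmat_mulVec (by omega) α F h1 h2]
    generalize ((i : ℕ) : ℤ) = z
    rcases lt_or_ge z m with hz | hz
    · have hlap := dirichletGS_laplacian hm0 hz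
      rw [hα0 (z - k) (by rw [lt_abs]; omega)]
      simp only [F]
      rw [dirichletGS_of_le (z := 2 * k - z) (by omega),
        dirichletGS_of_le (z := 2 * k - (z - 1)) (by omega),
        dirichletGS_of_le (z := 2 * k - (z + 1)) (by omega)]
      linear_combination c ^ 2 * dirichletGS m z * hlap
    rcases lt_or_ge (2 * k - z) m with hz' | hz'
    · have hlap := dirichletGS_laplacian hm0 hz'
      rw [hα0 (z - k) (by rw [lt_abs]; omega)]
      simp only [F]
      rw [dirichletGS_of_le (z := z) (by omega), dirichletGS_of_le (z := z - 1) (by omega),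
        dirichletGS_of_le (z := z + 1) (by omega), show 2 * k - (z - 1) = 2 * k - z + 1 by ring,
        show 2 * k - (z + 1) = 2 * k - z - 1 by ring]
      linear_combination d ^ 2 * dirichletGS m (2 * k - z) * hlap
    · simp only [F]
      rw [dirichletGS_of_le hz, dirichletGS_of_le hz']
      ring

theorem sin_mul_cos_le {θ c s : ℝ} (hθ : 0 < θ) (hθc : θ * c < Real.pi / 2)
    (hs : 0 < s) (hc : s⁻¹ ≤ c) : Real.sin θ * Real.cos (θ * c) ≤ s * Real.sin (θ * c) := by
  have hc0 : 0 < c := (inv_pos.mpr hs).trans_le hc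
  have hx : 0 < θ * c := mul_pos hθ hc0
  have hcos : 0 < Real.cos (θ * c) := Real.cos_pos_of_mem_Ioo ⟨by linarith [Real.pi_pos], hθc⟩
  have htan := Real.lt_tan hx hθc
  rw [Real.tan_eq_sin_div_cos, lt_div_iff₀ hcos] at htan
  have h1 : 1 ≤ s * c := by
    have := mul_le_mul_of_nonneg_left hc hs.le
    rwa [mul_inv_cancel₀ hs.ne'] at this
  calc Real.sin θ * Real.cos (θ * c) ≤ θ * Real.cos (θ * c) :=
        mul_le_mul_of_nonneg_right (Real.sin_le hθ.le) hcos.le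
    _ = 1 * (θ * Real.cos (θ * c)) := (one_mul _).symm
    _ ≤ (s * c) * (θ * Real.cos (θ * c)) :=
        mul_le_mul_of_nonneg_right h1 (mul_pos hθ hcos).le
    _ = s * (θ * c * Real.cos (θ * c)) := by ring
    _ ≤ s * Real.sin (θ * c) := mul_le_mul_of_nonneg_left htan.le hs.le

/-- Lower bound on the spectrum: a repulsive site `j` acts almost like a Dirichlet condition. -/
theorem le_evs_Hmat {k : ℕ} {α : ℤ → ℝ} (hα : ∀ i, 0 ≤ α i) {j : ℤ} (hj : 0 < α j)
    (hjk : |j| < k) {b : ℝ} (hb : |(j : ℝ)| + 1 / 2 + (α j / 2)⁻¹ ≤ b) {μ : ℝ}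
    (hμ : μ ∈ evs (Hmat k α)) : 2 - 2 * Real.cos (Real.pi / (2 * (k + b))) ≤ μ := by
  obtain ⟨hj1, hj2⟩ := abs_lt.mp hjk
  obtain ⟨hj3, hj4⟩ := abs_le.mp (le_refl |(j : ℝ)|)
  have hk : 1 ≤ k := by omega
  have hs : 0 < α j / 2 := by positivity
  have hsinv := inv_pos.mpr hs
  have hb0 : 0 < b := by linarith [abs_nonneg (j : ℝ)]
  set θ := Real.pi / (2 * (k + b)) with hθ
  have hθ0 : 0 < θ := by positivity
  have hpi : Real.pi / 2 = θ * (k + b) := by rw [hθ]; field_simp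
  set p : ℤ := k + j with hp
  have hpR : (p : ℝ) = k + j := by rw [hp]; push_cast; ring
  have hp0 : 0 < p := by omega
  have hp1 : p < 2 * k := by omega
  have hp0R : (0 : ℝ) < p := by exact_mod_cast hp0
  have hp1R : (p : ℝ) < 2 * k := by exact_mod_cast hp1
  let L : ℤ → ℝ := fun z => Real.cos (θ * (z + 1 / 2))
  let R : ℤ → ℝ := fun z => Real.cos (θ * (2 * k + 1 / 2 - z))
  have hcos : ∀ x : ℝ, 0 < x → x < k + b → 0 < Real.cos (θ * x) := fun x hx hx' => by
    refine Real.cos_pos_of_mem_Ioo ⟨?_, ?_⟩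
    · linarith [mul_pos hθ0 hx, Real.pi_pos]
    · rw [hpi]; exact mul_lt_mul_of_pos_left hx' hθ0
  have hLpos : ∀ z : ℤ, 0 ≤ z → z ≤ p → 0 < L z := fun z hz hz' => by
    have h1 : (0 : ℝ) ≤ z := by exact_mod_cast hz
    have h2 : (z : ℝ) ≤ p := by exact_mod_cast hz'
    exact hcos _ (by linarith) (by linarith)
  have hRpos : ∀ z : ℤ, p ≤ z → z ≤ 2 * k → 0 < R z := fun z hz hz' => by
    have h1 : (p : ℝ) ≤ z := by exact_mod_cast hz
    have h2 : (z : ℝ) ≤ 2 * k := by exact_mod_cast hz'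
    exact hcos _ (by linarith) (by linarith)
  have hLlap : ∀ z, 2 * L z - L (z - 1) - L (z + 1) = (2 - 2 * Real.cos θ) * L z := fun z => by
    rw [← two_mul_cos_sub_cos_sub_cos]
    simp only [L]
    push_cast
    ring_nf
  have hRlap : ∀ z, 2 * R z - R (z - 1) - R (z + 1) = (2 - 2 * Real.cos θ) * R z := fun z => by
    rw [← two_mul_cos_sub_cos_sub_cos]
    simp only [R]
    push_cast
    ring_nf
  let U : ℤ → ℝ := fun z => if p ≤ z then R z * L p else L z * R p
  have hUR : ∀ z, p ≤ z → U z = R z * L p := fun z hz => if_pos hz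
  have hUL : ∀ z, z ≤ p → U z = L z * R p := fun z hz => by
    rcases hz.lt_or_eq with h | rfl
    · exact if_neg (not_le.mpr h)
    · rw [hUR _ le_rfl, mul_comm]
  have hUpos : ∀ z : ℤ, 0 ≤ z → z ≤ 2 * k → 0 < U z := fun z hz hz' => by
    rcases le_total p z with h | h
    · rw [hUR z h]; exact mul_pos (hRpos z h hz') (hLpos p hp0.le le_rfl)
    · rw [hUL z h]; exact mul_pos (hLpos z hz h) (hRpos p le_rfl hp1.le)
  have hU1 : U (-1) = U 0 := by
    rw [hUL _ (by omega), hUL _ hp0.le]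
    congr 1
    simp only [L]
    rw [← Real.cos_neg]
    push_cast
    ring_nf
  have hU2 : U (2 * k + 1) = U (2 * k) := by
    rw [hUR _ (by omega), hUR _ hp1.le]
    congr 1
    simp only [R]
    rw [← Real.cos_neg]
    push_cast
    ring_nf
  refine le_of_mem_evs_of_supersolution (u := fun i : Fin (2 * k + 1) => U (i : ℕ))
    (fun i j h => ?_) (fun i => hUpos _ (by omega) (by omega)) (fun i => ?_) hμ
  · rw [Hmat_apply_of_ne α h]; split_ifs <;> norm_num
  rw [Hmat_mulVec hk α U hU1 hU2]
  have hi0 : 0 < U (i : ℕ) := hUpos _ (by omega) (by omega)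
  have hpot := mul_nonneg (hα ((i : ℕ) - k)) hi0.le
  generalize ((i : ℕ) : ℤ) = z at *
  rcases lt_trichotomy z p with h | rfl | h
  · rw [hUL _ h.le, hUL _ (by omega : z - 1 ≤ p), hUL _ (by omega : z + 1 ≤ p)] at *
    linear_combination hpot - R p * hLlap z
  · rw [hUL _ le_rfl, hUL _ (by omega : p - 1 ≤ p), hUR _ (by omega : p ≤ p + 1),
      show p - k = j by omega]
    have hA := sin_mul_cos_le (c := b - j - 1 / 2) hθ0 (by
      rw [hpi]; exact mul_lt_mul_of_pos_left (by linarith) hθ0) hs (by linarith)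
    have hB := sin_mul_cos_le (c := b + j - 1 / 2) hθ0 (by
      rw [hpi]; exact mul_lt_mul_of_pos_left (by linarith) hθ0) hs (by linarith)
    rw [← Real.sin_pi_div_two_sub (θ * (b - j - 1 / 2)),
      ← Real.cos_pi_div_two_sub (θ * (b - j - 1 / 2)), hpi, ← mul_sub,
      show (k : ℝ) + b - (b - j - 1 / 2) = p + 1 / 2 by rw [hpR]; ring] at hA
    rw [← Real.sin_pi_div_two_sub (θ * (b + j - 1 / 2)),
      ← Real.cos_pi_div_two_sub (θ * (b + j - 1 / 2)), hpi, ← mul_sub,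
      show (k : ℝ) + b - (b + j - 1 / 2) = 2 * k + 1 / 2 - p by rw [hpR]; ring] at hB
    have hL1 : L (p - 1) = L p * Real.cos θ + Real.sin (θ * (p + 1 / 2)) * Real.sin θ := by
      simp only [L]
      rw [← Real.cos_sub]
      push_cast
      ring_nf
    have hR1 : R (p + 1) =
        R p * Real.cos θ + Real.sin (θ * (2 * k + 1 / 2 - p)) * Real.sin θ := by
      simp only [R]
      rw [← Real.cos_sub]
      push_cast
      ring_nf
    have hA' := mul_le_mul_of_nonneg_right hA (hRpos p le_rfl hp1.le).le
    have hB' := mul_le_mul_of_nonneg_right hB (hLpos p hp0.le le_rfl).le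
    rw [hL1, hR1]
    change _ ≤ α j / 2 * L p * R p at hA'
    change _ ≤ α j / 2 * R p * L p at hB'
    linear_combination hA' + hB'
  · rw [hUR _ h.le, hUR _ (by omega : p ≤ z - 1), hUR _ (by omega : p ≤ z + 1)] at *
    linear_combination hpot - L p * hRlap z

theorem cos_sub_cos_le {x y : ℝ} (hxy : x ≤ y) (hx : 0 ≤ x) :
    2 * (Real.cos x - Real.cos y) ≤ (y + x) * (y - x) := by
  have h1 : |Real.sin ((x + y) / 2)| ≤ (x + y) / 2 :=
    Real.abs_sin_le_abs.trans (abs_of_nonneg (by linarith)).le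
  have h2 : |Real.sin ((x - y) / 2)| ≤ (y - x) / 2 :=
    Real.abs_sin_le_abs.trans (by rw [abs_of_nonpos (by linarith)]; linarith)
  have h3 := mul_le_mul h1 h2 (abs_nonneg _) (by linarith)
  rw [← abs_mul] at h3
  have h4 := (neg_le_abs _).trans h3
  rw [Real.cos_sub_cos]
  linarith

theorem gap_Hmat_nonneg {k a : ℕ} (hak : a < k) {α : ℤ → ℝ} (hα0 : ∀ j, 0 ≤ α j)
    (hα : ∀ j, α j ≠ 0 → |j| ≤ a) : 0 ≤ gap (Hmat k α) := by
  obtain ⟨μ, hμ, -⟩ := exists_evs_Hmat_le_dirEVZ hak hα (lam0 (Hmat k α))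
  exact sub_nonneg.mpr (csInf_le_csInf ⟨0, fun _ h => evs_Hmat_nonneg (by omega) hα0 h⟩ ⟨μ, hμ⟩
    Set.sdiff_subset)

theorem gap_Hmat_le {k a : ℕ} (hak : 2 * a < k) {α : ℤ → ℝ} (hα0 : ∀ j, 0 ≤ α j)
    (hα : ∀ j, α j ≠ 0 → |j| ≤ a) {j : ℤ} (hj : α j ≠ 0) :
    (2 * (k : ℝ) + 1) ^ 3 * gap (Hmat k α) ≤
      16 * Real.pi ^ 2 * (2 * a + 1 / 2 + (α j / 2)⁻¹) := by
  have hjpos : 0 < α j := (hα0 j).lt_of_ne' hj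
  have hja := hα j hj
  have hjaR : |(j : ℝ)| ≤ a := by exact_mod_cast hja
  have hs : 0 < (α j / 2)⁻¹ := by positivity
  set b : ℝ := a + 1 / 2 + (α j / 2)⁻¹ with hb
  have ha0 : (0 : ℝ) ≤ a := a.cast_nonneg
  have hakR : 2 * (a : ℝ) + 1 ≤ k := by exact_mod_cast hak
  have hlam0 : 2 - 2 * Real.cos (Real.pi / (2 * (k + b))) ≤ lam0 (Hmat k α) :=
    le_csInf (evs_nonempty (Hmat_isHermitian k α) 0) fun μ hμ =>
      le_evs_Hmat hα0 hjpos (by omega) (by linarith) hμ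
  obtain ⟨μ, hμ, hμE⟩ := exists_evs_Hmat_le_dirEVZ (by omega : a < k) hα (lam0 (Hmat k α))
  have hlam1 : lam1 (Hmat k α) ≤ dirEVZ (k - a) :=
    (csInf_le ⟨0, fun _ h => evs_Hmat_nonneg (by omega) hα0 h.1⟩ hμ).trans hμE
  rw [dirEVZ] at hlam1
  push_cast at hlam1
  set N : ℝ := 2 * k + 1 with hN
  have hN0 : 0 < N := by positivity
  set P : ℝ := 2 * (k + b) with hP
  set Q : ℝ := 2 * ((k : ℝ) - a) + 1 with hQ
  have hNP : N ≤ P := by linarith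
  have hQN : N ≤ 2 * Q := by linarith
  have hQ0 : 0 < Q := by linarith
  have hP0 : 0 < P := by linarith
  have hx0 : 0 < Real.pi / P := by positivity
  have hxy : Real.pi / P ≤ Real.pi / Q :=
    div_le_div_of_nonneg_left Real.pi_pos.le hQ0 (by linarith)
  have hyN : Real.pi / Q ≤ 2 * Real.pi / N := by
    rw [div_le_div_iff₀ hQ0 hN0]
    nlinarith [Real.pi_pos]
  have hsub : Real.pi / Q - Real.pi / P ≤ 4 * Real.pi * (a + b) / N ^ 2 := by
    have hPQ : N ^ 2 ≤ 2 * (Q * P) := by nlinarith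
    have hab : 0 ≤ P - Q := by linarith
    have hdiff : P - Q ≤ 2 * (a + b) := by linarith
    rw [div_sub_div _ _ hQ0.ne' hP0.ne', div_le_div_iff₀ (by positivity) (by positivity)]
    have h1 : (P - Q) * N ^ 2 ≤ 2 * (a + b) * (2 * (Q * P)) :=
      mul_le_mul hdiff hPQ (by positivity) (by linarith)
    nlinarith [mul_le_mul_of_nonneg_left h1 Real.pi_pos.le]
  have hgap : gap (Hmat k α) ≤ (4 * Real.pi / N) * (4 * Real.pi * (a + b) / N ^ 2) := by
    have h1 := cos_sub_cos_le hxy hx0.le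
    have h2 : Real.pi / Q + Real.pi / P ≤ 4 * Real.pi / N := by
      have : 4 * Real.pi / N = 2 * (2 * Real.pi / N) := by ring
      linarith
    have h3 := mul_le_mul h2 hsub (by linarith) (by positivity)
    rw [gap]
    linarith
  calc N ^ 3 * gap (Hmat k α) ≤ N ^ 3 * ((4 * Real.pi / N) * (4 * Real.pi * (a + b) / N ^ 2)) :=
        mul_le_mul_of_nonneg_left hgap (by positivity)
    _ = 16 * Real.pi ^ 2 * (2 * a + 1 / 2 + (α j / 2)⁻¹) := by
        rw [hb]
        field_simp
        ring

/-- Theorem 4.1(i): for `H_{k,α}` with a non-zero, non-negative, compactly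
supported potential there is `c₁ = c₁(α) > 0` with `|V_k|³ Γ(V_k, α) ≤ c₁` for all `k`;
in particular `|V_k|^{2+η} Γ(V_k, α) → 0` for every `η < 1`. -/
theorem stmt18 (α : ℤ → ℝ) (J : Finset ℤ) (hne : J.Nonempty)
    (hsupp : ∀ j : ℤ, α j ≠ 0 ↔ j ∈ J) (hpos : ∀ j ∈ J, 0 < α j) :
    (∃ c₁ : ℝ, 0 < c₁ ∧ ∀ k : ℕ, 1 ≤ k →
      ((2 * (k : ℝ) + 1) ^ 3) * gap (Hmat k α) ≤ c₁) ∧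
    ∀ η : ℝ, η < 1 →
      Tendsto (fun k : ℕ => (2 * (k : ℝ) + 1) ^ ((2 : ℝ) + η) * gap (Hmat k α))
        atTop (𝓝 0) := by
  have hα0 : ∀ j, 0 ≤ α j := fun j => by
    by_cases h : α j = 0
    · exact h.ge
    · exact (hpos j ((hsupp j).mp h)).le
  obtain ⟨a, ha⟩ : ∃ a : ℕ, ∀ j, α j ≠ 0 → |j| ≤ a := by
    refine ⟨J.sup Int.natAbs, fun j hj => ?_⟩
    rw [Int.abs_eq_natAbs]
    exact_mod_cast Finset.le_sup (f := Int.natAbs) ((hsupp j).mp hj)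
  obtain ⟨j, hj⟩ := hne
  have hjα : α j ≠ 0 := (hpos j hj).ne'
  set C : ℝ := 16 * Real.pi ^ 2 * (2 * a + 1 / 2 + (α j / 2)⁻¹) with hC
  have hC0 : 0 < C := by
    have := hpos j hj
    positivity
  constructor
  · refine ⟨C + ∑ k ∈ range (2 * a + 1), |(2 * (k : ℝ) + 1) ^ 3 * gap (Hmat k α)|,
      add_pos_of_pos_of_nonneg hC0 (Finset.sum_nonneg fun _ _ => abs_nonneg _), fun k _ => ?_⟩
    rcases Nat.lt_or_ge (2 * a) k with h | h
    · exact (gap_Hmat_le h hα0 ha hjα).trans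
        (le_add_of_nonneg_right (Finset.sum_nonneg fun _ _ => abs_nonneg _))
    · have h1 := Finset.single_le_sum
        (f := fun k : ℕ => |(2 * (k : ℝ) + 1) ^ 3 * gap (Hmat k α)|)
        (fun _ _ => abs_nonneg _) (mem_range.mpr (Nat.lt_succ_of_le h))
      exact (le_abs_self _).trans (h1.trans (le_add_of_nonneg_left hC0.le))
  · intro η hη
    have hN : Tendsto (fun k : ℕ => 2 * (k : ℝ) + 1) atTop atTop :=
      tendsto_atTop_add_const_right _ _
        (tendsto_natCast_atTop_atTop.const_mul_atTop two_pos)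
    have hlim : Tendsto (fun k : ℕ => (2 * (k : ℝ) + 1) ^ (-(1 - η)) * C) atTop (𝓝 0) := by
      simpa using ((tendsto_rpow_neg_atTop (sub_pos.mpr hη)).comp hN).mul_const C
    refine squeeze_zero' ?_ ?_ hlim
    · filter_upwards [eventually_gt_atTop a] with k hk
      exact mul_nonneg (by positivity) (gap_Hmat_nonneg hk hα0 ha)
    · filter_upwards [eventually_gt_atTop (2 * a)] with k hk
      have hpow : (2 * (k : ℝ) + 1) ^ ((2 : ℝ) + η) =
          (2 * (k : ℝ) + 1) ^ (-(1 - η)) * (2 * (k : ℝ) + 1) ^ 3 := by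
        rw [← Real.rpow_natCast, ← Real.rpow_add (by positivity)]
        congr 1
        push_cast
        ring
      rw [hpow, mul_assoc]
      exact mul_le_mul_of_nonneg_left (gap_Hmat_le hk hα0 ha hjα) (by positivity)
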